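/- Let W be a 2π-periodic weight function and let n be a positive integer. Then for every positive integer N satisfying N > (1/2)(∫_{-π}^{π} W(θ)dθ) · sup_{p ∈ T_n^+} (∫_{-π}^{π} |p'(θ)|dθ) / (∫_{-π}^{π} p(θ)W(θ)dθ), there exists a Chebyshev-type trigonometric quadrature of degree n for W with exactly N nodes. -/

import Mathlib

open MeasureTheory Real Set

noncomputable section

/-- A trigonometric polynomial of degree at most `n`. -/
def IsTrigPoly (n : ℕ) (p : ℝ → ℝ) : Prop :=
  ∃ a b : ℕ → ℝ, ∀ θ : ℝ,
    p θ = a 0 + ∑ k ∈ Finset.Icc 1 n, (a k * Real.cos (k * θ) + b k * Real.sin (k * θ))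

/-- A `2π`-periodic weight function. -/
def IsPeriodicWeight (W : ℝ → ℝ) : Prop :=
  Measurable W ∧ (∀ θ, 0 ≤ W θ) ∧ Function.Periodic W (2 * π) ∧
  IntervalIntegrable W volume (-π) π ∧ 0 < ∫ θ in (-π)..π, W θ

/-- A Chebyshev-type trigonometric quadrature of degree `n` for `W` with `N` nodes. -/
def IsTrigChebQuad (W : ℝ → ℝ) (n N : ℕ) (θs : Fin N → ℝ) : Prop :=
  Monotone θs ∧
  ∀ p : ℝ → ℝ, IsTrigPoly n p →
    (∫ θ in (-π)..π, p θ * W θ) =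
      ((∫ θ in (-π)..π, W θ) / N) * ∑ i, p (θs i)

section Brouwer

variable {E : Type*} [NormedAddCommGroup E] [InnerProductSpace ℝ E] [FiniteDimensional ℝ E]

/-- The determinant of `1 + t • A` is a polynomial in `t` of degree at most the dimension. -/
theorem exists_polynomial_eval_eq_det_one_add_smul (A : E →L[ℝ] E) :
    ∃ P : Polynomial ℝ, P.natDegree ≤ Module.finrank ℝ E ∧
      ∀ t : ℝ, P.eval t = (1 + t • A).det := by
  let b := Module.finBasis ℝ E
  let M := LinearMap.toMatrix b b (A : E →ₗ[ℝ] E)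
  refine ⟨((Polynomial.X : Polynomial ℝ) • M.map Polynomial.C + (1 : Matrix (Fin (Module.finrank ℝ E)) _ ℝ).map Polynomial.C).det, ?_, ?_⟩
  · simpa using Polynomial.natDegree_det_X_add_C_le M (1 : Matrix (Fin (Module.finrank ℝ E)) _ ℝ)
  · intro t
    rw [← Polynomial.coe_evalRingHom, RingHom.map_det, ContinuousLinearMap.det,
      ← LinearMap.det_toMatrix b]
    congr 1
    ext i j
    simp [M, LinearMap.toMatrix_apply, Matrix.one_apply, Finsupp.single_apply, eq_comm]
    split_ifs <;> simp [add_comm, mul_comm]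

theorem det_one_add_smul_pos {A : E →L[ℝ] E} {t : ℝ} (ht : 0 ≤ t) (hA : t * ‖A‖ < 1) :
    0 < (1 + t • A).det := by
  have hne : ∀ s ∈ Icc 0 t, (1 + s • A).det ≠ 0 := by
    intro s hs h0
    obtain ⟨v, hv, hv0⟩ := (Submodule.ne_bot_iff _).1
      (LinearMap.bot_lt_ker_of_det_eq_zero (f := ((1 + s • A : E →L[ℝ] E) : E →ₗ[ℝ] E)) h0).ne'
    have h1 : v + s • A v = 0 := by simpa using hv
    have h2 : ‖v‖ ≤ t * ‖A‖ * ‖v‖ := by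
      calc ‖v‖ = s * ‖A v‖ := by
            rw [← Real.norm_of_nonneg hs.1, ← norm_smul, ← norm_neg (s • A v),
              ← eq_neg_of_add_eq_zero_left h1]
        _ ≤ t * (‖A‖ * ‖v‖) := mul_le_mul hs.2 (A.le_opNorm v) (norm_nonneg _) ht
        _ = t * ‖A‖ * ‖v‖ := (mul_assoc _ _ _).symm
    have : 0 < ‖v‖ := norm_pos_iff.2 hv0
    nlinarith
  have hcont : Continuous fun s : ℝ => (1 + s • A).det :=
    ContinuousLinearMap.continuous_det.comp (by fun_prop)
  by_contra! hneg
  obtain ⟨s, hs, hs0⟩ := intermediate_value_Icc' ht hcont.continuousOn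
    (show (0 : ℝ) ∈ Icc _ _ from ⟨hneg, by simp [ContinuousLinearMap.det]⟩)
  exact hne s hs hs0

omit [FiniteDimensional ℝ E] in
/-- A function that is Lipschitz on a closed ball and vanishes on its boundary
stays Lipschitz when extended by zero. -/
theorem LipschitzOnWith.indicator_closedBall {h : E → E} {K : NNReal} {R : ℝ}
    (hK : LipschitzOnWith K h (Metric.closedBall 0 R)) (h0 : ∀ x ∈ Metric.sphere 0 R, h x = 0) :
    LipschitzWith K ((Metric.closedBall 0 R).indicator h) := by
  have key : ∀ x ∈ Metric.closedBall (0 : E) R, ∀ y ∉ Metric.closedBall (0 : E) R,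
      ‖h x‖ ≤ K * dist x y := by
    intro x hx y hy
    have hx' : ‖x‖ ≤ R := by simpa using hx
    have hy' : R < ‖y‖ := by simpa using hy
    have hc : ContinuousOn (fun s : ℝ => ‖x + s • (y - x)‖) (Icc 0 1) := by fun_prop
    obtain ⟨s, hs, hsR⟩ := intermediate_value_Icc zero_le_one hc
      (show R ∈ Icc _ _ from ⟨by simpa using hx', by simpa using hy'.le⟩)
    have hz : x + s • (y - x) ∈ Metric.sphere (0 : E) R := by simpa using hsR
    have := hK.dist_le_mul x hx _ (Metric.sphere_subset_closedBall hz)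
    rw [h0 _ hz, dist_zero_right] at this
    refine this.trans (mul_le_mul_of_nonneg_left ?_ K.2)
    rw [dist_eq_norm, sub_add_cancel_left, norm_neg, norm_smul, Real.norm_of_nonneg hs.1,
      ← dist_eq_norm, dist_comm y x]
    exact mul_le_of_le_one_left dist_nonneg hs.2
  refine LipschitzWith.of_dist_le_mul fun x y => ?_
  by_cases hx : x ∈ Metric.closedBall (0 : E) R <;> by_cases hy : y ∈ Metric.closedBall (0 : E) R
  · simpa [hx, hy] using hK.dist_le_mul x hx y hy
  · simpa [indicator, hx, hy] using key x hx y hy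
  · simpa [indicator, hx, hy, dist_comm] using key y hy x hx
  · simpa [indicator, hx, hy] using mul_nonneg K.2 dist_nonneg

/-- There is no continuously differentiable retraction of a closed ball onto its boundary. -/
theorem false_of_contDiffOn_retraction {R : ℝ} (hR : 0 < R) {r : E → E} {U : Set E}
    (hU : IsOpen U) (hBU : Metric.closedBall 0 R ⊆ U) (hr : ContDiffOn ℝ 1 r U)
    (hnorm : ∀ x ∈ Metric.closedBall 0 R, ‖r x‖ = R) (hid : ∀ x ∈ Metric.sphere 0 R, r x = x) :
    False := by
  borelize E
  set B := Metric.closedBall (0 : E) R with hB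
  have hBc : IsCompact B := isCompact_closedBall 0 R
  let h : E → E := fun x => r x - x
  have hh : ContDiffOn ℝ 1 h U := hr.sub contDiffOn_id
  have hdiff : ∀ x ∈ B, DifferentiableAt ℝ h x := fun x hx =>
    (hh.differentiableOn one_ne_zero).differentiableAt (hU.mem_nhds (hBU hx))
  have hDc : ContinuousOn (fderiv ℝ h) B :=
    (hh.continuousOn_fderiv_of_isOpen hU le_rfl).mono hBU
  obtain ⟨C, hC⟩ := hBc.exists_bound_of_continuousOn hDc
  let K : NNReal := ⟨max C 1, by positivity⟩
  have hK : ∀ x ∈ B, ‖fderiv ℝ h x‖ ≤ K := fun x hx => (hC x hx).trans (le_max_left _ _)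
  have hK1 : (1 : ℝ) ≤ K := le_max_right _ _
  have hlipB : LipschitzOnWith K h B :=
    (convex_closedBall 0 R).lipschitzOnWith_of_nnnorm_fderiv_le hdiff hK
  have hlip : LipschitzWith K (B.indicator h) :=
    hlipB.indicator_closedBall fun x hx => by simp [h, hid x hx]
  -- the maps `x ↦ x + t • h x` are bijections of the ball for small `t`
  have hvol : ∀ t : ℝ, 0 ≤ t → t * K < 1 →
      ∫ x in B, (1 + t • fderiv ℝ h x).det = volume.real B := by
    intro t ht htK
    let T : NNReal := ⟨t, ht⟩
    have hlipt : LipschitzWith (T * K) fun x => t • B.indicator h x :=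
      LipschitzWith.of_dist_le_mul fun x y => by
        rw [dist_smul₀, Real.norm_of_nonneg ht, NNReal.coe_mul, mul_assoc]
        exact mul_le_mul_of_nonneg_left (hlip.dist_le_mul x y) ht
    have hTK : T * K < 1 := by exact_mod_cast (show ((T * K : NNReal) : ℝ) < 1 from htK)
    let g : E → E := fun x => x + t • h x
    have hginj : InjOn g B := by
      intro x hx y hy hxy
      have h1 := hlipt.dist_le_mul x y
      simp only [indicator_of_mem hx, indicator_of_mem hy] at h1
      have h2 : x - y = t • h y - t • h x := by
        have : x + t • h x = y + t • h y := hxy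
        rw [sub_eq_sub_iff_add_eq_add, this, add_comm]
      rw [dist_comm, dist_eq_norm, ← h2, dist_eq_norm] at h1
      have h3 : ((T * K : NNReal) : ℝ) < 1 := htK
      by_contra hne
      have : 0 < ‖x - y‖ := norm_pos_iff.2 (sub_ne_zero.2 hne)
      nlinarith
    have ht1 : t ≤ 1 := by nlinarith
    have hgB : g '' B = B := by
      apply Subset.antisymm
      · rintro _ ⟨x, hx, rfl⟩
        have h1 : g x = (1 - t) • x + t • r x := by
          simp only [g, h, smul_sub, sub_smul, one_smul]; abel
        rw [h1]
        exact convex_closedBall 0 R hx (by simp [hnorm x hx]) (by linarith) ht (by ring)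
      · intro y hy
        have hcontr : ContractingWith (T * K) fun x => y - t • B.indicator h x := by
          refine ⟨hTK, LipschitzWith.of_dist_le_mul fun a b => ?_⟩
          rw [dist_sub_left]
          exact hlipt.dist_le_mul a b
        have hfix := hcontr.fixedPoint_isFixedPt
        set z := ContractingWith.fixedPoint _ hcontr
        have hz : y - t • B.indicator h z = z := hfix
        by_cases hzB : z ∈ B
        · exact ⟨z, hzB, by rw [indicator_of_mem hzB] at hz; exact (sub_eq_iff_eq_add.1 hz).symm⟩
        · rw [indicator_of_notMem hzB, smul_zero, sub_zero] at hz
          exact absurd (hz ▸ hy) hzB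
    have hgd : ∀ x ∈ B, HasFDerivWithinAt g (1 + t • fderiv ℝ h x) B x := fun x hx =>
      ((hasFDerivAt_id x).add ((hdiff x hx).hasFDerivAt.const_smul t)).hasFDerivWithinAt
    have hcv := integral_image_eq_integral_abs_det_fderiv_smul volume
      Metric.isClosed_closedBall.measurableSet hgd hginj fun _ => (1 : ℝ)
    rw [hgB] at hcv
    rw [setIntegral_congr_fun (g := fun x => |(1 + t • fderiv ℝ h x).det| • (1 : ℝ))
      Metric.isClosed_closedBall.measurableSet, ← hcv]
    · simp
    · intro x hx
      have := det_one_add_smul_pos (A := fderiv ℝ h x) ht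
        ((mul_le_mul_of_nonneg_left (hK x hx) ht).trans_lt htK)
      simp [abs_of_pos this]
  have hdetc : ∀ t : ℝ, ContinuousOn (fun x => (1 + t • fderiv ℝ h x).det) B := fun t =>
    ContinuousLinearMap.continuous_det.comp_continuousOn
      (continuousOn_const.add (hDc.const_smul t))
  have hdet0 : ∀ x ∈ B, (1 + (1 : ℝ) • fderiv ℝ h x).det = 0 := by
    have hball : EqOn (fun x => (1 + (1 : ℝ) • fderiv ℝ h x).det) 0 (Metric.ball 0 R) := by
      intro x hx
      have hxB : x ∈ B := Metric.ball_subset_closedBall hx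
      have hrd : HasFDerivAt r (1 + (1 : ℝ) • fderiv ℝ h x) x := by
        have := (hasFDerivAt_id x).add (hdiff x hxB).hasFDerivAt
        rw [one_smul]
        refine this.congr_of_eventuallyEq (Filter.Eventually.of_forall fun y => ?_)
        simp [h]
      set A := 1 + (1 : ℝ) • fderiv ℝ h x with hA
      have h1 := hrd.inner ℝ hrd
      have h2 : HasFDerivAt (fun y => inner ℝ (r y) (r y)) (0 : E →L[ℝ] ℝ) x := by
        refine (hasFDerivAt_const (R ^ 2) x).congr_of_eventuallyEq ?_
        filter_upwards [Metric.isOpen_ball.mem_nhds hx] with y hy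
        rw [real_inner_self_eq_norm_sq, hnorm y (Metric.ball_subset_closedBall hy)]
      have h3 : ∀ v, inner ℝ (r x) (A v) = 0 := by
        intro v
        have := DFunLike.congr_fun (h1.unique h2) v
        simp [real_inner_comm] at this
        simpa [real_inner_comm] using this
      by_contra hdet
      have hu : IsUnit (A : E →ₗ[ℝ] E) :=
        (LinearMap.isUnit_iff_isUnit_det _).2 (isUnit_iff_ne_zero.2 hdet)
      obtain ⟨v, hv⟩ := ((Module.End.isUnit_iff _).1 hu).2 (r x)
      have h4 := h3 v
      rw [show A v = r x from hv, inner_self_eq_zero] at h4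
      have := hnorm x hxB
      rw [h4, norm_zero] at this
      exact hR.ne this
    exact hball.of_subset_closure (hdetc 1) continuousOn_const Metric.ball_subset_closedBall
      (closure_ball (0 : E) hR.ne').ge
  -- interpolate at small nodes
  choose P hPdeg hP using fun x : E => exists_polynomial_eval_eq_det_one_add_smul (fderiv ℝ h x)
  let d := Module.finrank ℝ E
  let v : ℕ → ℝ := fun j => j / ((d + 1) * K)
  have hd : (0 : ℝ) < (d + 1) * K := by positivity
  have hvinj : InjOn v (Finset.range (d + 1)) := fun i _ j _ hij => by
    simpa [v, div_left_inj' hd.ne'] using hij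
  let c : ℕ → ℝ := fun j => (Lagrange.basis (Finset.range (d + 1)) v j).eval 1
  have hc : ∑ j ∈ Finset.range (d + 1), c j = 1 := by
    simp only [c]
    rw [← Polynomial.eval_finsetSum, Lagrange.sum_basis hvinj (by simp), Polynomial.eval_one]
  have hint : ∀ x, (1 + (1 : ℝ) • fderiv ℝ h x).det =
      ∑ j ∈ Finset.range (d + 1), c j * (1 + v j • fderiv ℝ h x).det := by
    intro x
    have hdeg : (P x).degree < (Finset.range (d + 1)).card := by
      rw [Finset.card_range]
      exact Polynomial.degree_le_natDegree.trans_lt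
        (by exact_mod_cast Nat.lt_succ_of_le (hPdeg x))
    rw [← hP x, Lagrange.eq_interpolate hvinj hdeg, Lagrange.interpolate_apply,
      Polynomial.eval_finsetSum]
    refine Finset.sum_congr rfl fun j _ => ?_
    rw [Polynomial.eval_mul, Polynomial.eval_C, hP x, mul_comm]
  have h0 : ∫ x in B, (1 + (1 : ℝ) • fderiv ℝ h x).det = 0 :=
    setIntegral_eq_zero_of_forall_eq_zero hdet0
  simp_rw [hint] at h0
  rw [integral_finsetSum _ fun j _ =>
    ((hdetc (v j)).integrableOn_compact hBc).const_mul (c j)] at h0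
  have hsum : ∀ j ∈ Finset.range (d + 1),
      ∫ x in B, c j * (1 + v j • fderiv ℝ h x).det = c j * volume.real B := by
    intro j hj
    rw [integral_const_mul, hvol (v j) (by positivity)]
    have hj' : (j : ℝ) < d + 1 := by exact_mod_cast Finset.mem_range.1 hj
    have hK0 : (0 : ℝ) < K := by linarith
    simp only [v]
    rw [div_mul_eq_mul_div, div_lt_one hd]
    exact mul_lt_mul_of_pos_right hj' hK0
  rw [Finset.sum_congr rfl hsum, ← Finset.sum_mul, hc, one_mul] at h0
  have hpos : 0 < volume.real B :=
    ENNReal.toReal_pos (Metric.measure_closedBall_pos volume 0 hR).ne'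
      hBc.measure_lt_top.ne
  exact hpos.ne' h0

/-- A continuously differentiable vector field pointing outwards on a sphere vanishes somewhere
in the ball. -/
theorem exists_eq_zero_of_contDiff {R : ℝ} (hR : 0 < R) {F : E → E} (hF : ContDiff ℝ 1 F)
    (hout : ∀ x ∈ Metric.sphere 0 R, 0 < inner ℝ (F x) x) :
    ∃ x ∈ Metric.closedBall 0 R, F x = 0 := by
  by_contra! hne
  -- `r x` is the exit point of the ray from `x` in the direction `F x`
  let D : E → ℝ := fun x => inner ℝ (F x) x ^ 2 + ‖F x‖ ^ 2 * (R ^ 2 - ‖x‖ ^ 2)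
  let s : E → ℝ := fun x => (√(D x) - inner ℝ (F x) x) / ‖F x‖ ^ 2
  have hn : ContDiff ℝ 1 fun x => ‖F x‖ ^ 2 := hF.norm_sq ℝ
  have hi : ContDiff ℝ 1 fun x => inner ℝ (F x) x := hF.inner ℝ contDiff_id
  have hDs : ContDiff ℝ 1 D :=
    (hi.pow 2).add (hn.mul (contDiff_const.sub (contDiff_id.norm_sq ℝ)))
  let U : Set E := {x | F x ≠ 0} ∩ {x | 0 < D x}
  have hU : IsOpen U := (isOpen_ne_fun hF.continuous continuous_const).inter
    (isOpen_lt continuous_const hDs.continuous)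
  have hD0 : ∀ x ∈ Metric.closedBall (0 : E) R, 0 < D x := by
    intro x hx
    have hxR : ‖x‖ ≤ R := by simpa using hx
    have hFx : 0 < ‖F x‖ := norm_pos_iff.2 (hne x hx)
    rcases hxR.lt_or_eq with hlt | heq
    · have : 0 < R ^ 2 - ‖x‖ ^ 2 := by nlinarith [norm_nonneg x]
      positivity
    · have := hout x (by simpa using heq)
      simp only [D, heq, sub_self, mul_zero, add_zero]
      positivity
  have hs : ContDiffOn ℝ 1 s U := fun x hx =>
    (((hDs.contDiffAt.sqrt hx.2.ne').sub hi.contDiffAt).div hn.contDiffAt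
      (by simpa using hx.1)).contDiffWithinAt
  refine false_of_contDiffOn_retraction (r := fun x => x + s x • F x) hR hU
    (fun x hx => ⟨hne x hx, hD0 x hx⟩) (contDiffOn_id.add (hs.smul hF.contDiffOn)) ?_ ?_
  · intro x hx
    have hFx : ‖F x‖ ≠ 0 := norm_ne_zero_iff.2 (hne x hx)
    have h1 : ‖x + s x • F x‖ ^ 2 = R ^ 2 := by
      have h2 : s x * ‖F x‖ ^ 2 = √(D x) - inner ℝ (F x) x := by
        simp only [s]; field_simp
      have h3 : √(D x) ^ 2 = D x := Real.sq_sqrt (hD0 x hx).le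
      rw [norm_add_sq_real, inner_smul_right, norm_smul, mul_pow, Real.norm_eq_abs, sq_abs,
        real_inner_comm]
      have h4 : ‖F x‖ ^ 2 * (‖x‖ ^ 2 + 2 * (s x * inner ℝ (F x) x) + s x ^ 2 * ‖F x‖ ^ 2) =
          ‖F x‖ ^ 2 * R ^ 2 := by
        have h5 : (s x * ‖F x‖ ^ 2 + inner ℝ (F x) x) ^ 2 = D x := by rw [h2, sub_add_cancel, h3]
        simp only [D] at h5
        linear_combination h5
      exact mul_left_cancel₀ (pow_ne_zero 2 hFx) h4
    exact (pow_left_inj₀ (norm_nonneg _) hR.le two_ne_zero).1 h1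
  · intro x hx
    have hxR : ‖x‖ = R := by simpa using hx
    simp [s, D, hxR, Real.sqrt_sq (hout x hx).le]

/-- A continuous vector field pointing outwards on a sphere vanishes somewhere. -/
theorem exists_eq_zero_of_inner_pos_on_sphere {R : ℝ} (hR : 0 < R) {G : E → E}
    (hG : Continuous G) (hout : ∀ x ∈ Metric.sphere 0 R, 0 < inner ℝ (G x) x) :
    ∃ x, G x = 0 := by
  by_contra! hne
  have hBc : IsCompact (Metric.closedBall (0 : E) R) := isCompact_closedBall 0 R
  have hSc : IsCompact (Metric.sphere (0 : E) R) := isCompact_sphere 0 R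
  obtain ⟨m, hm0, hm⟩ : ∃ m > 0, ∀ x ∈ Metric.closedBall (0 : E) R, m ≤ ‖G x‖ :=
    hBc.exists_forall_le' hG.norm.continuousOn fun x _ => norm_pos_iff.2 (hne x)
  obtain ⟨c, hc0, hc⟩ : ∃ c > 0, ∀ x ∈ Metric.sphere (0 : E) R, c ≤ inner ℝ (G x) x :=
    hSc.exists_forall_le' (hG.inner continuous_id).continuousOn hout
  obtain ⟨F, hF, hFG, -⟩ := hG.exists_contDiff_approx 1 (ε := fun _ => min m (c / R))
    continuous_const fun _ => by positivity
  have hF1 : ∀ x, ‖F x - G x‖ < m := fun x => by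
    rw [← dist_eq_norm]; exact (hFG x).trans_le (min_le_left _ _)
  have hF2 : ∀ x, ‖F x - G x‖ < c / R := fun x => by
    rw [← dist_eq_norm]; exact (hFG x).trans_le (min_le_right _ _)
  obtain ⟨x, hx, hx0⟩ := exists_eq_zero_of_contDiff hR hF fun x hx => by
    have hxR : ‖x‖ = R := by simpa using hx
    have h1 := abs_real_inner_le_norm (F x - G x) x
    have h2 : ‖F x - G x‖ * ‖x‖ < c := by
      rw [hxR]; exact (lt_div_iff₀ hR).1 (hF2 x)
    rw [inner_sub_left] at h1
    have := hc x hx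
    linarith [(abs_le.1 h1).1]
  have := hF1 x
  rw [hx0, zero_sub, norm_neg] at this
  exact (hm x hx).not_gt this

end Brouwer

section Quantiles

theorem strictMono_integral_of_pos {f : ℝ → ℝ} (hf : Continuous f) (hpos : ∀ t, 0 < f t) (a : ℝ) :
    StrictMono fun t => ∫ s in a..t, f s := by
  intro s t hst
  have h := intervalIntegral.integral_add_adjacent_intervals
    (hf.intervalIntegrable (μ := volume) a s) (hf.intervalIntegrable s t)
  have := intervalIntegral.intervalIntegral_pos_of_pos (hf.intervalIntegrable s t) hpos hst
  simp only
  linarith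

/-- Quantiles of a continuous positive density depend continuously on parameters. -/
theorem exists_continuous_quantile {X : Type*} [TopologicalSpace X] {f : X → ℝ → ℝ}
    (hf : Continuous f.uncurry) (hpos : ∀ x t, 0 < f x t) {a b : ℝ} (hab : a ≤ b)
    {c : X → ℝ} (hc : Continuous c) (hc0 : ∀ x, 0 ≤ c x) (hcb : ∀ x, c x ≤ ∫ t in a..b, f x t) :
    ∃ y : X → ℝ, Continuous y ∧ ∀ x, y x ∈ Icc a b ∧ ∫ t in a..y x, f x t = c x := by
  have hfx : ∀ x, Continuous (f x) := fun x => hf.comp (by fun_prop : Continuous fun t => (x, t))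
  have hmono := fun x => strictMono_integral_of_pos (hfx x) (hpos x) a
  have hex : ∀ x, ∃ y ∈ Icc a b, ∫ t in a..y, f x t = c x := fun x =>
    intermediate_value_Icc hab
      (intervalIntegral.continuous_primitive (fun s t => (hfx x).intervalIntegrable s t)
        a).continuousOn ⟨by simpa using hc0 x, hcb x⟩
  choose y hy hyc using hex
  refine ⟨y, ?_, fun x => ⟨hy x, hyc x⟩⟩
  have hcont : ∀ s, Continuous fun x => ∫ t in a..s, f x t := fun s =>
    intervalIntegral.continuous_parametric_intervalIntegral_of_continuous' hf a s
  rw [continuous_iff_continuousAt]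
  intro x
  refine tendsto_order.2 ⟨fun l hl => ?_, fun u hu => ?_⟩
  · have := hmono x hl
    simp only [hyc] at this
    filter_upwards [(hcont l).continuousAt.eventually_lt hc.continuousAt this] with z hz
    rw [← hyc z] at hz
    exact (hmono z).lt_iff_lt.1 hz
  · have := hmono x hu
    simp only [hyc] at this
    filter_upwards [hc.continuousAt.eventually_lt (hcont u).continuousAt this] with z hz
    rw [← hyc z] at hz
    exact (hmono z).lt_iff_lt.1 hz

theorem sub_le_integral_abs_deriv {f : ℝ → ℝ} (hf : ContDiff ℝ 1 f) {c d s t : ℝ}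
    (hs : s ∈ Icc c d) (ht : t ∈ Icc c d) : f t - f s ≤ ∫ u in c..d, |deriv f u| := by
  have hf' : Continuous (deriv f) := hf.continuous_deriv_one
  have hcd : c ≤ d := hs.1.trans hs.2
  rw [← intervalIntegral.integral_deriv_eq_sub
    (fun x _ => (hf.differentiable one_ne_zero).differentiableAt) (hf'.intervalIntegrable s t)]
  have h := intervalIntegral.norm_integral_le_integral_norm_uIoc (f := deriv f) (a := s) (b := t)
    (μ := volume)
  simp only [Real.norm_eq_abs] at h
  refine (le_abs_self _).trans (h.trans ?_)
  rw [intervalIntegral.integral_of_le hcd]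
  refine setIntegral_mono_set (hf'.abs.integrableOn_Ioc) (ae_of_all _ fun _ => abs_nonneg _) ?_
  exact (Ioc_subset_Ioc (le_min hs.1 ht.1) (max_le hs.2 ht.2)).eventuallyLE

theorem integral_mul_le_of_mem_Icc {f ρ : ℝ → ℝ} (hf : ContDiff ℝ 1 f) (hρ : Continuous ρ)
    (hρ0 : ∀ t, 0 ≤ ρ t) {c d q : ℝ} (hq : q ∈ Icc c d) :
    ∫ t in c..d, f t * ρ t ≤ (f q + ∫ u in c..d, |deriv f u|) * ∫ t in c..d, ρ t := by
  rw [← intervalIntegral.integral_const_mul]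
  refine intervalIntegral.integral_mono_on (hq.1.trans hq.2)
    ((hf.continuous.mul hρ).intervalIntegrable _ _)
    ((continuous_const.mul hρ).intervalIntegrable _ _) fun t ht => ?_
  refine mul_le_mul_of_nonneg_right ?_ (hρ0 t)
  linarith [sub_le_integral_abs_deriv hf hq ht]

/-- The average over the odd `2N`-quantiles of a density differs from the mean by at most
`1 / (2N)` times the total variation. -/
theorem mul_integral_le_sum_quantiles {f ρ : ℝ → ℝ} (hf : ContDiff ℝ 1 f) (hρ : Continuous ρ)
    (hρ0 : ∀ t, 0 < ρ t) {a b : ℝ} {N : ℕ} (hN : 0 < N) {y : ℕ → ℝ}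
    (hy : ∀ j ≤ 2 * N, ∫ t in a..y j, ρ t = j / (2 * N) * ∫ t in a..b, ρ t)
    (hab : a < b) :
    N * ∫ t in a..b, f t * ρ t ≤ (∫ t in a..b, ρ t) *
      ((∑ i ∈ Finset.range N, f (y (2 * i + 1))) + (∫ t in a..b, |deriv f t|) / 2) := by
  set Z := ∫ t in a..b, ρ t with hZ
  have hmono := strictMono_integral_of_pos hρ hρ0 a
  have hN' : (0 : ℝ) < N := by exact_mod_cast hN
  have hZ0 : 0 < Z := intervalIntegral.intervalIntegral_pos_of_pos
    (hρ.intervalIntegrable _ _) hρ0 hab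
  have hya : y 0 = a := hmono.injective (by simp [hy 0 (Nat.zero_le _)])
  have hyb : y (2 * N) = b := hmono.injective (by
    simp only [hy _ le_rfl]; push_cast; rw [div_self (by positivity), one_mul])
  have hcell : ∀ j < 2 * N, y j ≤ y (j + 1) ∧ ∫ t in y j..y (j + 1), ρ t = Z / (2 * N) := by
    intro j hj
    have h1 := hy j hj.le
    have h2 := hy (j + 1) hj
    constructor
    · rw [← hmono.le_iff_le]
      simp only [h1, h2]
      gcongr
      simp
    · rw [← intervalIntegral.integral_interval_sub_left (hρ.intervalIntegrable a _)
        (hρ.intervalIntegrable a _), h1, h2]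
      push_cast
      ring
  have hfρ : Continuous fun t => f t * ρ t := hf.continuous.mul hρ
  have hf' : Continuous fun t => |deriv f t| := hf.continuous_deriv_one.abs
  have hstep : ∀ i ∈ Finset.range N, ∫ t in y (2 * i)..y (2 * (i + 1)), f t * ρ t ≤
      Z / (2 * N) * (2 * f (y (2 * i + 1)) +
        ∫ t in y (2 * i)..y (2 * (i + 1)), |deriv f t|) := by
    intro i hi
    have hi' := Finset.mem_range.1 hi
    obtain ⟨l1, e1⟩ := hcell (2 * i) (by omega)
    obtain ⟨l2, e2⟩ := hcell (2 * i + 1) (by omega)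
    have h1 := integral_mul_le_of_mem_Icc hf hρ (fun t => (hρ0 t).le) (right_mem_Icc.2 l1)
    have h2 := integral_mul_le_of_mem_Icc hf hρ (fun t => (hρ0 t).le) (left_mem_Icc.2 l2)
    rw [show 2 * (i + 1) = 2 * i + 1 + 1 by ring,
      ← intervalIntegral.integral_add_adjacent_intervals (hfρ.intervalIntegrable _ _)
        (hfρ.intervalIntegrable (y (2 * i + 1)) _),
      ← intervalIntegral.integral_add_adjacent_intervals (hf'.intervalIntegrable _ _)
        (hf'.intervalIntegrable (y (2 * i + 1)) _)]
    rw [e1] at h1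
    rw [e2] at h2
    linarith
  have hsum := Finset.sum_le_sum hstep
  rw [intervalIntegral.sum_integral_adjacent_intervals (a := fun i => y (2 * i))
      fun i _ => hfρ.intervalIntegrable _ _, ← Finset.mul_sum, Finset.sum_add_distrib,
    intervalIntegral.sum_integral_adjacent_intervals (a := fun i => y (2 * i))
      fun i _ => hf'.intervalIntegrable _ _, ← Finset.mul_sum] at hsum
  simp only [mul_zero, hya, hyb] at hsum
  calc N * ∫ t in a..b, f t * ρ t ≤ N * _ := mul_le_mul_of_nonneg_left hsum hN'.le
    _ = _ := by field_simp

end Quantiles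

section Gibbs

theorem log_sub_log_mul_le_integral_mul_exp {f : ℝ → ℝ} (hf : Continuous f) {a b : ℝ}
    (hab : a < b) :
    (log (∫ t in a..b, exp (f t)) - log (b - a)) * (∫ t in a..b, exp (f t)) ≤
      ∫ t in a..b, f t * exp (f t) := by
  set Z := ∫ t in a..b, exp (f t) with hZ
  have he : Continuous fun t => exp (f t) := by fun_prop
  have hZ0 : 0 < Z := intervalIntegral.intervalIntegral_pos_of_pos
    (he.intervalIntegrable _ _) (fun _ => exp_pos _) hab
  have hba : 0 < b - a := sub_pos.2 hab
  have key : ∫ t in a..b, (exp (f t) - Z / (b - a)) ≤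
      ∫ t in a..b, (f t * exp (f t) - (log Z - log (b - a)) * exp (f t)) := by
    refine intervalIntegral.integral_mono_on hab.le
      (Continuous.intervalIntegrable (by fun_prop) _ _)
      (Continuous.intervalIntegrable (by fun_prop) _ _) fun t _ => ?_
    have h1 := add_one_le_exp (log Z - log (b - a) - f t)
    have h2 : exp (f t) * exp (log Z - log (b - a) - f t) = Z / (b - a) := by
      rw [← exp_add, add_sub_cancel, exp_sub, exp_log hZ0, exp_log hba]
    nlinarith [exp_pos (f t)]
  rw [intervalIntegral.integral_sub (he.intervalIntegrable _ _) (by simp),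
    intervalIntegral.integral_sub (Continuous.intervalIntegrable (by fun_prop) _ _)
      (Continuous.intervalIntegrable (by fun_prop) _ _),
    intervalIntegral.integral_const_mul, intervalIntegral.integral_const, smul_eq_mul,
    mul_div_cancel₀ _ hba.ne', ← hZ, sub_self] at key
  linarith

theorem mul_exp_le_integral_exp {f : ℝ → ℝ} (hf : Continuous f) {a b θ L δ : ℝ}
    (hθ : θ ∈ Icc a b) (hL : ∀ t ∈ Icc a b, f θ - L * |t - θ| ≤ f t) (hL0 : 0 ≤ L)
    (hδ : 0 ≤ δ) (hδb : δ ≤ (b - a) / 2) :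
    δ * exp (f θ - L * δ) ≤ ∫ t in a..b, exp (f t) := by
  obtain ⟨c, hac, hcb, hcθ, hθc⟩ : ∃ c, a ≤ c ∧ c + δ ≤ b ∧ c ≤ θ ∧ θ ≤ c + δ := by
    by_cases h : θ + δ ≤ b
    · exact ⟨θ, hθ.1, h, le_rfl, by linarith⟩
    · exact ⟨θ - δ, by linarith [hθ.2], by linarith [hθ.2], by linarith, by linarith⟩
  have he : Continuous fun t => exp (f t) := by fun_prop
  calc δ * exp (f θ - L * δ) = ∫ _ in c..c + δ, exp (f θ - L * δ) := by simp
    _ ≤ ∫ t in c..c + δ, exp (f t) := by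
        refine intervalIntegral.integral_mono_on (by linarith) (by simp)
          (he.intervalIntegrable _ _) fun t ht => exp_le_exp.2 ?_
        refine le_trans ?_ (hL t ⟨hac.trans ht.1, ht.2.trans hcb⟩)
        have : |t - θ| ≤ δ := abs_le.2 ⟨by linarith [ht.1], by linarith [ht.2]⟩
        nlinarith
    _ ≤ ∫ t in a..b, exp (f t) :=
        intervalIntegral.integral_mono_interval hac (by linarith) hcb
          (ae_of_all _ fun _ => (exp_pos _).le) (he.intervalIntegrable _ _)

end Gibbs

section Nodes

variable {E : Type*} [NormedAddCommGroup E] [InnerProductSpace ℝ E] [FiniteDimensional ℝ E]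

theorem exists_pos_mul_norm_le_inner {Φ : ℝ → E} (hΦ : Continuous Φ) {a b : ℝ} (hab : a ≤ b)
    (hpos : ∀ x ≠ 0, ∃ θ ∈ Icc a b, 0 < inner ℝ x (Φ θ)) :
    ∃ m > 0, ∀ x, ∃ θ ∈ Icc a b, m * ‖x‖ ≤ inner ℝ x (Φ θ) := by
  have hc : Continuous fun x : E => sSup ((fun θ => inner ℝ x (Φ θ)) '' Icc a b) :=
    isCompact_Icc.continuous_sSup (f := fun (x : E) θ => inner ℝ x (Φ θ))
      (by simp only [Function.HasUncurry.uncurry, id]; fun_prop)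
  have hex : ∀ x : E, ∃ θ ∈ Icc a b, sSup ((fun θ => inner ℝ x (Φ θ)) '' Icc a b) =
      inner ℝ x (Φ θ) := fun x =>
    isCompact_Icc.exists_sSup_image_eq (nonempty_Icc.2 hab) (by fun_prop)
  obtain ⟨m, hm0, hm⟩ := (isCompact_sphere (0 : E) 1).exists_forall_le' hc.continuousOn
    (a := 0) fun x hx => by
      obtain ⟨θ, hθ, h⟩ := hpos x (by rintro rfl; simp at hx)
      refine h.trans_le (le_csSup (isCompact_Icc.bddAbove_image (by fun_prop)) ⟨θ, hθ, rfl⟩)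
  refine ⟨m, hm0, fun x => ?_⟩
  rcases eq_or_ne x 0 with rfl | hx
  · exact ⟨a, left_mem_Icc.2 hab, by simp⟩
  · have hx' : 0 < ‖x‖ := norm_pos_iff.2 hx
    obtain ⟨θ, hθ, h⟩ := hex (‖x‖⁻¹ • x)
    refine ⟨θ, hθ, ?_⟩
    have := hm (‖x‖⁻¹ • x) (by simp [norm_smul, hx'.ne'])
    rw [h, inner_smul_left] at this
    simp only [map_inv₀, conj_trivial] at this
    rwa [inv_mul_eq_div, le_div_iff₀ hx'] at this

/-- If every nonzero linear functional of the curve `Φ` has total variation less than `2 N` times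
its maximum, uniformly, then some `N` points of the curve sum to zero. -/
theorem exists_monotone_sum_eq_zero {Φ : ℝ → E} (hΦ : ContDiff ℝ 1 Φ) {a b : ℝ} (hab : a < b)
    {N : ℕ} (hN : 0 < N) {κ : ℝ} (hκ : κ < 1)
    (hpos : ∀ x ≠ 0, ∃ θ ∈ Icc a b, 0 < inner ℝ x (Φ θ))
    (hvar : ∀ x ≠ 0, ∀ M : ℝ, (∀ θ ∈ Icc a b, inner ℝ x (Φ θ) ≤ M) →
      ∫ θ in a..b, |deriv (fun θ => inner ℝ x (Φ θ)) θ| ≤ 2 * N * (κ * M)) :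
    ∃ θs : Fin N → ℝ, Monotone θs ∧ ∑ i, Φ (θs i) = 0 := by
  have hN' : (0 : ℝ) < N := by exact_mod_cast hN
  have hΦc : Continuous Φ := hΦ.continuous
  let w : E → ℝ → ℝ := fun x t => exp (inner ℝ x (Φ t))
  have hw : Continuous w.uncurry := by
    simp only [w, Function.uncurry_def]; fun_prop
  have hwx : ∀ x, Continuous (w x) := fun x => by simp only [w]; fun_prop
  have hw0 : ∀ x t, 0 < w x t := fun x t => exp_pos _
  let Z : E → ℝ := fun x => ∫ t in a..b, w x t
  have hZ0 : ∀ x, 0 < Z x := fun x => intervalIntegral.intervalIntegral_pos_of_pos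
    ((hwx x).intervalIntegrable _ _) (hw0 x) hab
  have hZc : Continuous Z :=
    intervalIntegral.continuous_parametric_intervalIntegral_of_continuous' hw a b
  have hq : ∀ j : ℕ, ∃ y : E → ℝ, Continuous y ∧
      (j ≤ 2 * N → ∀ x, ∫ t in a..y x, w x t = j / (2 * N) * Z x) := by
    intro j
    by_cases hj : j ≤ 2 * N
    · have hj' : (j : ℝ) / (2 * N) ≤ 1 := by
        rw [div_le_one (by positivity)]; exact_mod_cast hj
      obtain ⟨y, hyc, hy⟩ := exists_continuous_quantile hw hw0 hab.le
        (c := fun x => j / (2 * N) * Z x) (by fun_prop)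
        (fun x => mul_nonneg (by positivity) (hZ0 x).le)
        (fun x => mul_le_of_le_one_left (hZ0 x).le hj')
      exact ⟨y, hyc, fun _ x => (hy x).2⟩
    · exact ⟨0, continuous_zero, fun h => absurd h hj⟩
  choose y hyc hy using hq
  let G : E → E := fun x => ∑ i ∈ Finset.range N, Φ (y (2 * i + 1) x)
  have hGc : Continuous G := continuous_finsetSum _ fun i _ => hΦc.comp (hyc _)
  obtain ⟨m, hm0, hm⟩ := exists_pos_mul_norm_le_inner hΦc hab.le hpos
  obtain ⟨C, hC⟩ := isCompact_Icc.exists_bound_of_continuousOn (s := Icc a b)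
    (hΦ.continuous_deriv_one).continuousOn
  have hC0 : 0 ≤ C := (norm_nonneg _).trans (hC a (left_mem_Icc.2 hab.le))
  have hlip : ∀ s ∈ Icc a b, ∀ t ∈ Icc a b, ‖Φ t - Φ s‖ ≤ C * ‖t - s‖ := fun s hs t ht =>
    (convex_Icc a b).norm_image_sub_le_of_norm_deriv_le
      (fun x _ => (hΦ.differentiable one_ne_zero).differentiableAt) hC hs ht
  have hκ0 : 0 < 1 - κ := by linarith
  let δ : ℝ := min ((b - a) / 2) ((1 - κ) * m / (2 * (C + 1)))
  have hba : 0 < b - a := by linarith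
  have hδ0 : 0 < δ := by positivity
  have hδb : δ ≤ (b - a) / 2 := min_le_left _ _
  have hδC : C * δ ≤ (1 - κ) * m / 2 := by
    have h1 : δ ≤ (1 - κ) * m / (2 * (C + 1)) := min_le_right _ _
    rw [le_div_iff₀ (by positivity)] at h1
    nlinarith
  have hlog : 0 ≤ log (b - a) - log δ := sub_nonneg.2 (log_le_log hδ0 (by linarith))
  let R : ℝ := 2 * (log (b - a) - log δ) / ((1 - κ) * m) + 1
  have hR : 0 < R := by positivity
  have hRlog : log (b - a) - log δ < (1 - κ) * m / 2 * R := by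
    have hk : 0 < (1 - κ) * m := by positivity
    have : (1 - κ) * m / 2 * R = log (b - a) - log δ + (1 - κ) * m / 2 := by
      simp only [R]; field_simp
    linarith
  obtain ⟨x, hx⟩ := exists_eq_zero_of_inner_pos_on_sphere hR hGc fun x hx => by
    have hxR : ‖x‖ = R := by simpa using hx
    have hx0 : x ≠ 0 := by rintro rfl; simp at hxR; exact hR.ne hxR
    let f : ℝ → ℝ := fun t => inner ℝ x (Φ t)
    have hf : ContDiff ℝ 1 f := contDiff_const.inner ℝ hΦ
    obtain ⟨θ, hθ, hmax⟩ := isCompact_Icc.exists_isMaxOn (nonempty_Icc.2 hab.le)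
      hf.continuous.continuousOn
    have hMm : m * R ≤ f θ := by
      obtain ⟨s, hs, h⟩ := hm x
      rw [hxR] at h
      exact h.trans (hmax hs)
    have hL : ∀ t ∈ Icc a b, f θ - R * C * |t - θ| ≤ f t := by
      intro t ht
      have h1 : f θ - f t = inner ℝ x (Φ θ - Φ t) := by simp [f, inner_sub_right]
      have h2 := (real_inner_le_norm x (Φ θ - Φ t)).trans
        (mul_le_mul_of_nonneg_left (hlip t ht θ hθ) (norm_nonneg _))
      rw [← h1, hxR, Real.norm_eq_abs, abs_sub_comm] at h2
      linarith
    have h1 := mul_exp_le_integral_exp hf.continuous hθ hL (by positivity) hδ0.le hδb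
    have h2 := log_sub_log_mul_le_integral_mul_exp hf.continuous hab
    have h3 := mul_integral_le_sum_quantiles hf (hwx x) (hw0 x) hN (y := fun j => y j x)
      (fun j hj => hy j hj x) hab
    have h4 := hvar x hx0 (f θ) fun t ht => hmax ht
    have h5 : log δ + (f θ - R * C * δ) ≤ log (Z x) := by
      rw [← log_exp (f θ - R * C * δ), ← log_mul hδ0.ne' (exp_pos _).ne']
      exact log_le_log (by positivity) h1
    have h6 : inner ℝ (G x) x = ∑ i ∈ Finset.range N, f (y (2 * i + 1) x) := by
      simp only [G, f, sum_inner, real_inner_comm]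
    rw [h6]
    have h7 : N * (log (Z x) - log (b - a)) ≤ (∑ i ∈ Finset.range N, f (y (2 * i + 1) x)) +
        (∫ t in a..b, |deriv f t|) / 2 := by
      have h8 := (mul_le_mul_of_nonneg_left h2 hN'.le).trans h3
      refine le_of_mul_le_mul_left ?_ (hZ0 x)
      calc Z x * (N * (log (Z x) - log (b - a))) = N * ((log (Z x) - log (b - a)) * Z x) := by
            ring
        _ ≤ _ := h8
    have h9 : (1 - κ) * (m * R) ≤ (1 - κ) * f θ := mul_le_mul_of_nonneg_left hMm hκ0.le
    have h10 : R * (C * δ) ≤ R * ((1 - κ) * m / 2) := mul_le_mul_of_nonneg_left hδC hR.le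
    have h11 : 0 < log (Z x) - log (b - a) - κ * f θ := by linarith
    have h12 := mul_pos hN' h11
    linarith
  refine ⟨fun i => y (2 * i + 1) x, fun i j hij => ?_, ?_⟩
  · rw [← (strictMono_integral_of_pos (hwx x) (hw0 x) a).le_iff_le]
    simp only
    rw [hy _ (by omega), hy _ (by omega)]
    have := (hZ0 x).le
    have hij' : (i : ℕ) ≤ j := hij
    gcongr
  · rw [← hx]
    exact Fin.sum_univ_eq_sum_range (fun i => Φ (y (2 * i + 1) x)) N

end Nodes

section TrigPoly

/-- The space of trigonometric polynomials of degree at most `n`. -/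
def trigPolySubmodule (n : ℕ) : Submodule ℝ (ℝ → ℝ) where
  carrier := {p | IsTrigPoly n p}
  zero_mem' := ⟨0, 0, fun θ => by simp⟩
  add_mem' := by
    rintro p q ⟨a, b, hp⟩ ⟨c, d, hq⟩
    refine ⟨a + c, b + d, fun θ => ?_⟩
    simp only [Pi.add_apply, hp, hq]
    rw [add_add_add_comm, ← Finset.sum_add_distrib]
    congr 1
    exact Finset.sum_congr rfl fun k _ => by ring
  smul_mem' := by
    rintro r p ⟨a, b, hp⟩
    refine ⟨r • a, r • b, fun θ => ?_⟩
    simp only [Pi.smul_apply, smul_eq_mul, hp, mul_add, Finset.mul_sum]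
    congr 1
    exact Finset.sum_congr rfl fun k _ => by ring

variable {n : ℕ}

theorem isTrigPoly_const (c : ℝ) : IsTrigPoly n fun _ => c :=
  ⟨fun k => if k = 0 then c else 0, 0, fun θ => by
    rw [Finset.sum_eq_zero fun k hk => ?_]
    · simp
    · have : k ≠ 0 := by have := (Finset.mem_Icc.1 hk).1; omega
      simp [this]⟩

theorem isTrigPoly_cos {k : ℕ} (hk : k ≤ n) : IsTrigPoly n fun θ => cos (k * θ) := by
  rcases Nat.eq_zero_or_pos k with rfl | hk0
  · simpa using isTrigPoly_const 1
  · exact ⟨Pi.single k 1, 0, fun θ => by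
      simp [Pi.single_apply, hk0.ne', hk, Nat.one_le_iff_ne_zero]⟩

theorem isTrigPoly_sin {k : ℕ} (hk : k ≤ n) : IsTrigPoly n fun θ => sin (k * θ) := by
  rcases Nat.eq_zero_or_pos k with rfl | hk0
  · simpa using isTrigPoly_const 0
  · exact ⟨0, Pi.single k 1, fun θ => by
      simp [Pi.single_apply, hk0.ne', hk, Nat.one_le_iff_ne_zero]⟩

variable {p : ℝ → ℝ}

theorem IsTrigPoly.analyticOnNhd (hp : IsTrigPoly n p) : AnalyticOnNhd ℝ p univ := by
  obtain ⟨a, b, h⟩ := hp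
  rw [funext h]
  intro x _
  fun_prop

theorem IsTrigPoly.continuous (hp : IsTrigPoly n p) : Continuous p := by
  obtain ⟨a, b, h⟩ := hp
  rw [funext h]
  fun_prop

theorem IsTrigPoly.periodic (hp : IsTrigPoly n p) : Function.Periodic p (2 * π) := by
  obtain ⟨a, b, h⟩ := hp
  intro θ
  rw [h, h]
  congr 1
  refine Finset.sum_congr rfl fun k _ => ?_
  rw [mul_add, cos_add_nat_mul_two_pi, sin_add_nat_mul_two_pi]

theorem IsTrigPoly.nonneg_of_nonneg_on_Icc (hp : IsTrigPoly n p)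
    (h : ∀ θ ∈ Icc (-π) π, 0 ≤ p θ) (θ : ℝ) : 0 ≤ p θ := by
  obtain ⟨φ, hφ, he⟩ := hp.periodic.exists_mem_Ico two_pi_pos θ (-π)
  rw [he]
  exact h φ ⟨hφ.1, by linarith [hφ.2]⟩

theorem IsTrigPoly.ae_ne_zero (hp : IsTrigPoly n p) (h0 : p ≠ 0) : ∀ᵐ θ, p θ ≠ 0 := by
  obtain ⟨x, hx⟩ := Function.ne_iff.1 h0
  have h1 := hp.analyticOnNhd.preimage_zero_mem_codiscrete (x := x) hx
  have h2 := ae_restrict_le_codiscreteWithin (μ := volume) MeasurableSet.univ h1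
  rwa [Measure.restrict_univ] at h2

end TrigPoly

section Weight

variable {W : ℝ → ℝ} {n : ℕ} {p : ℝ → ℝ}

theorem IsTrigPoly.intervalIntegrable_mul (hp : IsTrigPoly n p) (hW : IsPeriodicWeight W) :
    IntervalIntegrable (fun θ => p θ * W θ) volume (-π) π :=
  hW.2.2.2.1.continuousOn_mul hp.continuous.continuousOn

theorem IsTrigPoly.integral_mul_pos (hp : IsTrigPoly n p) (hW : IsPeriodicWeight W)
    (h0 : p ≠ 0) (hnn : ∀ θ, 0 ≤ p θ) : 0 < ∫ θ in (-π)..π, p θ * W θ := by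
  have hle : -π ≤ π := by linarith [pi_pos]
  refine (intervalIntegral.integral_nonneg hle
    fun θ _ => mul_nonneg (hnn θ) (hW.2.1 θ)).lt_of_ne' fun hz => hW.2.2.2.2.ne' ?_
  have hi := hp.intervalIntegrable_mul hW
  rw [intervalIntegral.integral_eq_zero_iff_of_le_of_nonneg_ae hle
    (ae_of_all _ fun θ => mul_nonneg (hnn θ) (hW.2.1 θ)) hi] at hz
  rw [intervalIntegral.integral_of_le hle]
  refine integral_eq_zero_of_ae ?_
  filter_upwards [hz, ae_restrict_of_ae (hp.ae_ne_zero h0)] with θ h1 h2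
  exact (mul_eq_zero.1 h1).resolve_left h2

/-- The functions `cos (kθ)` and `sin (kθ)` for `k ≤ n`. -/
def trigMonomial (n : ℕ) : Fin (n + 1) ⊕ Fin (n + 1) → ℝ → ℝ :=
  Sum.elim (fun k θ => cos (k * θ)) fun k θ => sin (k * θ)

theorem isTrigPoly_trigMonomial (i : Fin (n + 1) ⊕ Fin (n + 1)) :
    IsTrigPoly n (trigMonomial n i) := by
  rcases i with k | k
  · exact isTrigPoly_cos (Nat.lt_succ_iff.1 k.2)
  · exact isTrigPoly_sin (Nat.lt_succ_iff.1 k.2)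

/-- The trigonometric moment curve, centred with respect to the weight `W`. -/
def centredMomentCurve (W : ℝ → ℝ) (n : ℕ) (θ : ℝ) :
    EuclideanSpace ℝ (Fin (n + 1) ⊕ Fin (n + 1)) :=
  WithLp.toLp 2 fun i => trigMonomial n i θ -
    (∫ φ in (-π)..π, trigMonomial n i φ * W φ) / ∫ φ in (-π)..π, W φ

theorem contDiff_centredMomentCurve : ContDiff ℝ 1 (centredMomentCurve W n) := by
  refine (contDiff_euclidean ..).2 fun i => ?_
  simp only [centredMomentCurve, trigMonomial]
  rcases i with k | k <;> simp only [Sum.elim_inl, Sum.elim_inr] <;> fun_prop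

theorem inner_centredMomentCurve (x : EuclideanSpace ℝ (Fin (n + 1) ⊕ Fin (n + 1))) :
    (fun θ => inner ℝ x (centredMomentCurve W n θ)) = ∑ i, x i • (trigMonomial n i - fun _ =>
      (∫ φ in (-π)..π, trigMonomial n i φ * W φ) / ∫ φ in (-π)..π, W φ) := by
  ext θ
  simp [PiLp.inner_apply, centredMomentCurve, mul_comm]

theorem isTrigPoly_inner_centredMomentCurve
    (x : EuclideanSpace ℝ (Fin (n + 1) ⊕ Fin (n + 1))) :
    IsTrigPoly n fun θ => inner ℝ x (centredMomentCurve W n θ) := by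
  rw [inner_centredMomentCurve]
  exact (trigPolySubmodule n).sum_mem fun i _ => (trigPolySubmodule n).smul_mem _
    ((trigPolySubmodule n).sub_mem (isTrigPoly_trigMonomial i) (isTrigPoly_const _))

theorem integral_inner_centredMomentCurve_mul (hW : IsPeriodicWeight W)
    (x : EuclideanSpace ℝ (Fin (n + 1) ⊕ Fin (n + 1))) :
    ∫ θ in (-π)..π, inner ℝ x (centredMomentCurve W n θ) * W θ = 0 := by
  have hq : ∀ i, IsTrigPoly n (trigMonomial n i - fun _ =>
      (∫ φ in (-π)..π, trigMonomial n i φ * W φ) / ∫ φ in (-π)..π, W φ) := fun i =>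
    (trigPolySubmodule n).sub_mem (isTrigPoly_trigMonomial i) (isTrigPoly_const _)
  have h := inner_centredMomentCurve (W := W) x
  simp_rw [funext_iff] at h
  simp_rw [h, Finset.sum_apply, Pi.smul_apply, smul_eq_mul, Finset.sum_mul, mul_assoc]
  rw [intervalIntegral.integral_finsetSum fun i _ =>
    ((hq i).intervalIntegrable_mul hW).const_mul _]
  refine Finset.sum_eq_zero fun i _ => ?_
  rw [intervalIntegral.integral_const_mul]
  simp_rw [Pi.sub_apply, sub_mul]
  rw [intervalIntegral.integral_sub ((isTrigPoly_trigMonomial i).intervalIntegrable_mul hW)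
    (hW.2.2.2.1.const_mul _), intervalIntegral.integral_const_mul,
    div_mul_cancel₀ _ hW.2.2.2.2.ne', sub_self, mul_zero]

/-- Nodes at which the centred moment curve sums to zero form a quadrature. -/
theorem isTrigChebQuad_of_sum_centredMomentCurve_eq_zero (hW : IsPeriodicWeight W) {N : ℕ}
    (hN : 0 < N) {θs : Fin N → ℝ} (hmono : Monotone θs)
    (hsum : ∑ i, centredMomentCurve W n (θs i) = 0) : IsTrigChebQuad W n N θs := by
  have hN' : (N : ℝ) ≠ 0 := by exact_mod_cast hN.ne'
  have hmon : ∀ i, ∫ θ in (-π)..π, trigMonomial n i θ * W θ =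
      ((∫ θ in (-π)..π, W θ) / N) * ∑ j, trigMonomial n i (θs j) := by
    intro i
    have h := congrArg (fun v => v i) hsum
    simp only [WithLp.ofLp_sum, Finset.sum_apply, centredMomentCurve, Finset.sum_sub_distrib,
      PiLp.zero_apply, Finset.sum_const, Finset.card_univ, Fintype.card_fin, nsmul_eq_mul] at h
    have := hW.2.2.2.2.ne'
    rw [sub_eq_zero.1 h]
    field_simp
  refine ⟨hmono, ?_⟩
  rintro p ⟨a, b, hp⟩
  have hcos : ∀ k ∈ Finset.Icc 1 n, ∫ θ in (-π)..π, cos (k * θ) * W θ =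
      ((∫ θ in (-π)..π, W θ) / N) * ∑ j, cos (k * θs j) := fun k hk =>
    hmon (Sum.inl ⟨k, Nat.lt_succ_of_le (Finset.mem_Icc.1 hk).2⟩)
  have hsin : ∀ k ∈ Finset.Icc 1 n, ∫ θ in (-π)..π, sin (k * θ) * W θ =
      ((∫ θ in (-π)..π, W θ) / N) * ∑ j, sin (k * θs j) := fun k hk =>
    hmon (Sum.inr ⟨k, Nat.lt_succ_of_le (Finset.mem_Icc.1 hk).2⟩)
  have icos : ∀ k ∈ Finset.Icc 1 n,
      IntervalIntegrable (fun θ => a k * (cos (k * θ) * W θ)) volume (-π) π := fun k hk =>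
    ((isTrigPoly_cos (Finset.mem_Icc.1 hk).2).intervalIntegrable_mul hW).const_mul _
  have isin : ∀ k ∈ Finset.Icc 1 n,
      IntervalIntegrable (fun θ => b k * (sin (k * θ) * W θ)) volume (-π) π := fun k hk =>
    ((isTrigPoly_sin (Finset.mem_Icc.1 hk).2).intervalIntegrable_mul hW).const_mul _
  have isum : IntervalIntegrable (fun θ => ∑ k ∈ Finset.Icc 1 n,
      (a k * (cos (k * θ) * W θ) + b k * (sin (k * θ) * W θ))) volume (-π) π := by
    have := IntervalIntegrable.sum _ fun k hk => (icos k hk).add (isin k hk)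
    exact this.congr fun θ _ => by simp
  simp_rw [hp, add_mul, Finset.sum_mul, add_mul, mul_assoc]
  rw [intervalIntegral.integral_add (hW.2.2.2.1.const_mul _) isum,
    intervalIntegral.integral_finsetSum fun k hk => (icos k hk).add (isin k hk),
    Finset.sum_add_distrib, mul_add, Finset.sum_comm, intervalIntegral.integral_const_mul]
  congr 1
  · simp
    field_simp
  · rw [Finset.mul_sum]
    refine Finset.sum_congr rfl fun k hk => ?_
    rw [intervalIntegral.integral_add (icos k hk) (isin k hk),
      intervalIntegral.integral_const_mul, intervalIntegral.integral_const_mul, hcos k hk,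
      hsin k hk, Finset.sum_add_distrib, ← Finset.mul_sum, ← Finset.mul_sum]
    ring

end Weight

/-- Kane's bound: if `N > (1/2)(∫ W) · sup_{p ∈ T_n^+} (∫|p'|)/(∫ p W)`, then there is a
Chebyshev-type trigonometric quadrature of degree `n` for `W` with exactly `N` nodes.
The condition `N >` half the integral times the supremum is expressed by the existence of an
upper bound `S` of the ratios with `N > (1/2)(∫ W)·S`. -/
theorem kane_bound (W : ℝ → ℝ) (hW : IsPeriodicWeight W) (n : ℕ) (hn : 1 ≤ n)
    (N : ℕ) (hNpos : 1 ≤ N)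
    (hN : ∃ S : ℝ,
      (∀ p : ℝ → ℝ, IsTrigPoly n p → (∀ θ, 0 ≤ p θ) → p ≠ 0 →
        (∫ θ in (-π)..π, |deriv p θ|) / (∫ θ in (-π)..π, p θ * W θ) ≤ S) ∧
      (1/2) * (∫ θ in (-π)..π, W θ) * S < N) :
    ∃ θs : Fin N → ℝ, IsTrigChebQuad W n N θs := by
  obtain ⟨S, hS, hSN⟩ := hN
  have hN' : (0 : ℝ) < N := by exact_mod_cast hNpos
  let E := Submodule.span ℝ (range (centredMomentCurve W n))
  have hmem : ∀ θ, centredMomentCurve W n θ ∈ E := fun θ => Submodule.subset_span ⟨θ, rfl⟩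
  let Φ : ℝ → E := fun θ => ⟨centredMomentCurve W n θ, hmem θ⟩
  have hΦ : ContDiff ℝ 1 Φ := by
    have h : Φ = fun θ => E.orthogonalProjectionOnto (centredMomentCurve W n θ) := funext fun θ =>
      (E.orthogonalProjectionOnto_mem_subspace_eq_self (Φ θ)).symm
    rw [h]
    exact E.orthogonalProjectionOnto.contDiff.comp contDiff_centredMomentCurve
  have hin : ∀ (x : E) θ, inner ℝ x (Φ θ) =
      inner ℝ (x : EuclideanSpace ℝ (Fin (n + 1) ⊕ Fin (n + 1))) (centredMomentCurve W n θ) :=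
    fun x θ => rfl
  have htp : ∀ x : E, IsTrigPoly n fun θ => inner ℝ x (Φ θ) := fun x =>
    isTrigPoly_inner_centredMomentCurve _
  have hint : ∀ x : E, ∫ θ in (-π)..π, inner ℝ x (Φ θ) * W θ = 0 := fun x =>
    integral_inner_centredMomentCurve_mul hW _
  have hne : ∀ x : E, x ≠ 0 → (fun θ => inner ℝ x (Φ θ)) ≠ 0 := by
    intro x hx h0
    refine hx (Subtype.ext (inner_self_eq_zero (𝕜 := ℝ).1 ?_))
    exact Submodule.span_induction (p := fun v _ =>
        inner ℝ (x : EuclideanSpace ℝ (Fin (n + 1) ⊕ Fin (n + 1))) v = 0)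
      (by rintro _ ⟨θ, rfl⟩; exact congrFun h0 θ) (inner_zero_right _)
      (fun u v _ _ hu hv => by rw [inner_add_right, hu, hv, add_zero])
      (fun r u _ hu => by rw [inner_smul_right, hu, mul_zero]) x.2
  -- `M - f` for a nonzero mean-zero `f ≤ M`
  have hsub : ∀ x : E, x ≠ 0 → ∀ M : ℝ, (∀ θ ∈ Icc (-π) π, inner ℝ x (Φ θ) ≤ M) →
      ∀ p : ℝ → ℝ, (p = fun θ => M - inner ℝ x (Φ θ)) →
      IsTrigPoly n p ∧ (∀ θ, 0 ≤ p θ) ∧ p ≠ 0 ∧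
        ∫ θ in (-π)..π, p θ * W θ = M * ∫ θ in (-π)..π, W θ := by
    rintro x hx M hM p rfl
    have hp : IsTrigPoly n fun θ => M - inner ℝ x (Φ θ) :=
      (trigPolySubmodule n).sub_mem (isTrigPoly_const M) (htp x)
    have hpW : ∫ θ in (-π)..π, (M - inner ℝ x (Φ θ)) * W θ = M * ∫ θ in (-π)..π, W θ := by
      simp_rw [sub_mul]
      rw [intervalIntegral.integral_sub (hW.2.2.2.1.const_mul _)
        ((htp x).intervalIntegrable_mul hW), hint, sub_zero, intervalIntegral.integral_const_mul]
    refine ⟨hp, hp.nonneg_of_nonneg_on_Icc fun θ hθ => sub_nonneg.2 (hM θ hθ), fun h0 => ?_, hpW⟩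
    have h1 : ∀ θ, M - inner ℝ x (Φ θ) = 0 := congrFun h0
    have hM0 : M = 0 := by
      simp_rw [h1, zero_mul, intervalIntegral.integral_zero] at hpW
      exact (mul_eq_zero.1 hpW.symm).resolve_right hW.2.2.2.2.ne'
    exact hne x hx (funext fun θ => by simpa [hM0] using h1 θ)
  have hpos : ∀ x : E, x ≠ 0 → ∃ θ ∈ Icc (-π) π, 0 < inner ℝ x (Φ θ) := by
    intro x hx
    by_contra! hle
    obtain ⟨hp, hp0, hpne, hpW⟩ := hsub x hx 0 hle _ rfl
    have := hp.integral_mul_pos hW hpne hp0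
    rw [hpW, zero_mul] at this
    exact this.false
  obtain ⟨θs, hmono, hsum⟩ := exists_monotone_sum_eq_zero hΦ (neg_lt_self pi_pos) hNpos
    (κ := (1 / 2) * (∫ θ in (-π)..π, W θ) * S / N) ((div_lt_one hN').2 hSN) hpos
    fun x hx M hM => by
      obtain ⟨hp, hp0, hpne, hpW⟩ := hsub x hx M hM _ rfl
      have h1 := hS _ hp hp0 hpne
      rw [div_le_iff₀ (hp.integral_mul_pos hW hpne hp0), hpW] at h1
      simp only [deriv_const_sub, abs_neg] at h1
      refine h1.trans_eq ?_
      field_simp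
  refine ⟨θs, isTrigChebQuad_of_sum_centredMomentCurve_eq_zero hW hNpos hmono ?_⟩
  simpa [Φ] using congrArg (Subtype.val (p := (· ∈ E))) hsum
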